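/- Let ℓ_0 be slowly varying at ∞ and suppose ν_1[0,x] ~ x ℓ_0(1/x) as x → 0+, and let ℓ(y) = ∫_1^y u^{−1} ℓ_0(u) du. Then Φ(t) ~ ℓ(t) as t → ∞ and for every integer r ≥ 1, Φ_r(t) ~ (1/r) ℓ_0(t) as t → ∞; in particular ν_1[0,x] ~ x ℓ_0(1/x) (x → 0+) is equivalent to Φ_1(t) ~ ℓ_0(t) (t → ∞). Moreover, for any slowly varying ℓ, the conditions ν̄(x) ~ ℓ(1/x) (x → 0+) and Φ(t) ~ ℓ(t) (t → ∞) are equivalent, and either implies Φ_r(t)/Φ(t) → 0 as t → ∞ for every integer r ≥ 1. -/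

import Mathlib

open Filter Topology MeasureTheory

/-- Tail counting function `ν̄(x) = #{j : p_j ≥ x}`, as a real number. -/
noncomputable def nubar (p : ℕ → ℝ) (x : ℝ) : ℝ := ({j | x ≤ p j}.ncard : ℝ)

/-- `ν_1[0,x] = ∑_j p_j · 1(p_j ≤ x)`. -/
noncomputable def nuOne (p : ℕ → ℝ) (x : ℝ) : ℝ := ∑' j, if p j ≤ x then p j else 0

/-- Poissonized expected number of occupied boxes. -/
noncomputable def Phi (p : ℕ → ℝ) (t : ℝ) : ℝ := ∑' j, (1 - Real.exp (-t * p j))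

/-- Poissonized expected number of boxes occupied by exactly `r` balls:
`Φ_r(t) = (t^r / r!) ∑_j p_j^r e^{-t p_j}`. -/
noncomputable def PhiR (p : ℕ → ℝ) (r : ℕ) (t : ℝ) : ℝ :=
  t ^ r / (Nat.factorial r) * ∑' j, p j ^ r * Real.exp (-t * p j)

/-- A function `ℓ : (0,∞) → (0,∞)` is slowly varying at `∞` if
`ℓ(cy)/ℓ(y) → 1` as `y → ∞` for every `c > 0`. -/
def SlowlyVarying (ℓ : ℝ → ℝ) : Prop :=
  ∀ c : ℝ, 0 < c → Tendsto (fun y : ℝ => ℓ (c * y) / ℓ y) atTop (𝓝 1)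

/-- `ℓ(y) = ∫_1^y u^{-1} ℓ_0(u) du`. -/
noncomputable def ellInt (ℓ₀ : ℝ → ℝ) (y : ℝ) : ℝ := ∫ u in Set.Ioc 1 y, ℓ₀ u / u

section helpers
variable {p : ℕ → ℝ}

lemma sv_shift {F ℓ : ℝ → ℝ} (hℓ : ∀ y : ℝ, 0 < y → 0 < ℓ y) (hsv : SlowlyVarying ℓ)
    (h : Tendsto (fun t => F t / ℓ t) atTop (𝓝 1)) (c : ℝ) (hc : 0 < c) :
    Tendsto (fun t => F (c * t) / ℓ t) atTop (𝓝 1) := by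
  have h1 : Tendsto (fun t : ℝ => c * t) atTop atTop := tendsto_id.const_mul_atTop hc
  have h2 := (h.comp h1).mul (hsv c hc)
  rw [one_mul] at h2
  refine h2.congr' ?_
  filter_upwards [eventually_gt_atTop 0] with t ht
  have := (hℓ (c * t) (by positivity)).ne'
  simp only [Function.comp]
  field_simp

lemma zero_atTop_iff {f : ℝ → ℝ} {L : Filter ℝ} :
    Tendsto f (𝓝[>] 0) L ↔ Tendsto (fun t => f (1 / t)) atTop L := by
  constructor
  · intro h
    have := h.comp (tendsto_inv_atTop_nhdsGT_zero (𝕜 := ℝ))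
    refine this.congr fun x => ?_
    simp
  · intro h
    have := h.comp (tendsto_inv_nhdsGT_zero (𝕜 := ℝ))
    refine this.congr fun x => ?_
    simp

lemma fin_ge (hs : Summable p) {x : ℝ} (hx : 0 < x) : {j | x ≤ p j}.Finite := by
  have h := hs.tendsto_cofinite_zero
  have h2 := h.eventually (gt_mem_nhds hx)
  rw [Filter.eventually_cofinite] at h2
  simpa using h2

lemma nubar_summable (hs : Summable p) {x : ℝ} (hx : 0 < x) :
    Summable (fun j => if x ≤ p j then (1:ℝ) else 0) := by
  apply summable_of_hasFiniteSupport
  refine (fin_ge hs hx).subset ?_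
  intro j hj
  by_contra h
  simp at h hj
  linarith

lemma nubar_tsum (hs : Summable p) {x : ℝ} (hx : 0 < x) :
    nubar p x = ∑' j, if x ≤ p j then (1:ℝ) else 0 := by
  have hf := fin_ge hs hx
  rw [tsum_eq_sum (s := hf.toFinset)]
  · rw [Finset.sum_congr rfl (g := fun _ => (1:ℝ))]
    · simp [nubar, Set.ncard_eq_toFinset_card _ hf]
    · intro j hj
      simp at hj
      simp [hj]
  · intro j hj
    simp at hj
    simp [hj]

lemma phi_summable (hpos : ∀ j, 0 < p j) (hs : Summable p) {t : ℝ} (ht : 0 ≤ t) :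
    Summable (fun j => 1 - Real.exp (-t * p j)) := by
  refine Summable.of_nonneg_of_le (fun j => ?_) (fun j => ?_) (hs.mul_left t)
  · have : -t * p j ≤ 0 := by have := hpos j; nlinarith [mul_nonneg ht this.le]
    linarith [Real.exp_le_one_iff.2 this]
  · linarith [Real.add_one_le_exp (-t * p j)]

lemma B1 (hpos : ∀ j, 0 < p j) (hs : Summable p) {t M : ℝ} (ht : 0 < t) (hM : 0 < M) :
    (1 - Real.exp (-M)) * nubar p (M / t) ≤ Phi p t := by
  have hx : 0 < M / t := by positivity
  rw [nubar_tsum hs hx, ← tsum_mul_left, Phi]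
  refine Summable.tsum_le_tsum (fun j => ?_) ((nubar_summable hs hx).mul_left _)
    (phi_summable hpos hs ht.le)
  split_ifs with h
  · rw [div_le_iff₀ ht] at h
    have : Real.exp (-t * p j) ≤ Real.exp (-M) := Real.exp_le_exp.2 (by linarith)
    linarith
  · have : Real.exp (-t * p j) ≤ 1 := Real.exp_le_one_iff.2 (by nlinarith [mul_pos ht (hpos j)])
    linarith

lemma B2 (hpos : ∀ j, 0 < p j) (hs : Summable p) {t : ℝ} (ht : 0 < t) :
    Phi p t ≤ nubar p (1 / t) + Real.exp 1 * (Phi p (2 * t) - Phi p t) := by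
  have hx : 0 < 1 / t := by positivity
  have s1 := phi_summable hpos hs ht.le
  have s2 := phi_summable hpos hs (t := 2 * t) (by positivity)
  rw [nubar_tsum hs hx, Phi, Phi, ← s2.tsum_sub s1, ← tsum_mul_left,
    ← (nubar_summable hs hx).tsum_add ((s2.sub s1).mul_left _)]
  refine Summable.tsum_le_tsum (fun j => ?_) s1
    ((nubar_summable hs hx).add ((s2.sub s1).mul_left _))
  have e2 : Real.exp (-(2 * t) * p j) = Real.exp (-t * p j) * Real.exp (-t * p j) := by
    rw [← Real.exp_add]; ring_nf
  have e1 : Real.exp (-t * p j) ≤ 1 := Real.exp_le_one_iff.2 (by nlinarith [mul_pos ht (hpos j)])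
  have e0 := Real.exp_pos (-t * p j)
  have E := Real.exp_pos 1
  rw [e2]
  have k : 1 - Real.exp (-t * p j) * Real.exp (-t * p j) - (1 - Real.exp (-t * p j))
    = Real.exp (-t * p j) * (1 - Real.exp (-t * p j)) := by ring
  rw [k]
  split_ifs with h
  · have : 0 ≤ Real.exp 1 * (Real.exp (-t * p j) * (1 - Real.exp (-t * p j))) := by
      have : 0 ≤ 1 - Real.exp (-t * p j) := by linarith
      positivity
    linarith
  · have : p j * t < 1 := by rw [not_le, lt_div_iff₀ ht] at h; exact h
    have : 1 ≤ Real.exp 1 * Real.exp (-t * p j) := by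
      rw [← Real.exp_add]; exact Real.one_le_exp (by linarith)
    rw [zero_add, ← mul_assoc]
    nlinarith

lemma s_summable (hpos : ∀ j, 0 < p j) (hs : Summable p) (x : ℝ) :
    Summable (fun j => if p j < x then p j else 0) := by
  refine Summable.of_nonneg_of_le (fun j => ?_) (fun j => ?_) hs
  · split_ifs
    exacts [(hpos j).le, le_rfl]
  · split_ifs
    exacts [le_rfl, (hpos j).le]

lemma B3 (hpos : ∀ j, 0 < p j) (hs : Summable p) {t : ℝ} (ht : 0 < t) :
    Phi p t ≤ nubar p (1 / t) + t * ∑' j, if p j < 1 / t then p j else 0 := by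
  have hx : 0 < 1 / t := by positivity
  have s1 := phi_summable hpos hs ht.le
  have s2 := s_summable hpos hs (1 / t)
  rw [nubar_tsum hs hx, Phi, ← tsum_mul_left, ← (nubar_summable hs hx).tsum_add (s2.mul_left _)]
  refine Summable.tsum_le_tsum (fun j => ?_) s1 ((nubar_summable hs hx).add (s2.mul_left _))
  have e0 := Real.exp_pos (-t * p j)
  by_cases h : p j < 1 / t
  · simp only [h, not_le.2 h, if_true, if_false]
    linarith [Real.add_one_le_exp (-t * p j)]
  · simp only [h, not_lt.1 h, if_true, if_false]
    linarith

lemma B4 (hpos : ∀ j, 0 < p j) (hs : Summable p) {x : ℝ} (hx : 0 < x) :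
    (∑' j, if p j < x then p j else 0) ≤ x * (nubar p (x / 2) - nubar p x) +
      ∑' j, if p j < x / 2 then p j else 0 := by
  have hx2 : 0 < x / 2 := by positivity
  have n1 := nubar_summable hs hx
  have n2 := nubar_summable hs hx2
  have s1 := s_summable hpos hs x
  have s2 := s_summable hpos hs (x / 2)
  rw [nubar_tsum hs hx, nubar_tsum hs hx2, ← n2.tsum_sub n1, ← tsum_mul_left,
    ← ((n2.sub n1).mul_left x).tsum_add s2]
  refine Summable.tsum_le_tsum (fun j => ?_) s1 (((n2.sub n1).mul_left x).add s2)
  have := hpos j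
  split_ifs <;> linarith

lemma B4n (hpos : ∀ j, 0 < p j) (hs : Summable p) {x₀ ε : ℝ} (hε : 0 ≤ ε) (hε2 : ε ≤ 1 / 2)
    (h : ∀ x, 0 < x → x ≤ x₀ → nubar p (x / 2) ≤ (1 + ε) * nubar p x) (n : ℕ) :
    ∀ x, 0 < x → x ≤ x₀ → (∑' j, if p j < x then p j else 0) ≤
      4 * ε * (1 - (3 / 4) ^ n) * (x * nubar p x) + ∑' j, if p j < x / 2 ^ n then p j else 0 := by
  induction n with
  | zero => intro x _ _; simp
  | succ n ih =>
    intro x hx hx0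
    have h1 := B4 hpos hs hx
    have h2 := ih (x / 2) (by positivity) (by linarith)
    have h3 := h x hx hx0
    have hN : 0 ≤ nubar p x := Nat.cast_nonneg _
    have e : x / 2 / 2 ^ n = x / 2 ^ (n + 1) := by rw [pow_succ]; field_simp
    rw [e] at h2
    have q : (3 / 4 : ℝ) ^ n ≤ 1 := pow_le_one₀ (by norm_num) (by norm_num)
    have a1 : x * (nubar p (x / 2) - nubar p x) ≤ ε * (x * nubar p x) := by
      have : nubar p (x / 2) - nubar p x ≤ ε * nubar p x := by linarith
      nlinarith
    have a2 : x / 2 * nubar p (x / 2) ≤ 3 / 4 * (x * nubar p x) := by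
      have : nubar p (x / 2) ≤ 3 / 2 * nubar p x := by nlinarith
      nlinarith
    have a3 : 4 * ε * (1 - (3 / 4) ^ n) * (x / 2 * nubar p (x / 2)) ≤
       4 * ε * (1 - (3 / 4) ^ n) * (3 / 4 * (x * nubar p x)) :=
      mul_le_mul_of_nonneg_left a2 (mul_nonneg (by positivity) (by linarith))
    have a4 : 4 * ε * (1 - (3 / 4) ^ (n + 1)) * (x * nubar p x) = ε * (x * nubar p x) +
       4 * ε * (1 - (3 / 4) ^ n) * (3 / 4 * (x * nubar p x)) := by ring
    linarith

lemma s_tendsto (hpos : ∀ j, 0 < p j) (hs : Summable p) (x : ℝ) :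
    Tendsto (fun n : ℕ => ∑' j, if p j < x / 2 ^ n then p j else 0) atTop (𝓝 0) := by
  have := tendsto_tsum_of_dominated_convergence (𝓕 := atTop)
    (f := fun (n : ℕ) j => if p j < x / 2 ^ n then p j else 0) (g := fun _ => (0:ℝ)) hs
    (fun j => ?_) (Eventually.of_forall fun n j => ?_)
  · simpa using this
  · have : Tendsto (fun n : ℕ => x / 2 ^ n) atTop (𝓝 0) := by
      have := (tendsto_pow_atTop_nhds_zero_of_lt_one (r := (1/2 : ℝ)) (by norm_num)
        (by norm_num)).const_mul x
      simpa [div_eq_mul_inv] using this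
    refine tendsto_const_nhds.congr' ?_
    filter_upwards [this.eventually (gt_mem_nhds (hpos j))] with n hn
    simp [not_lt.2 hn.le]
  · have := hpos j
    split_ifs <;> simp [abs_of_pos, this, this.le]

lemma B4lim (hpos : ∀ j, 0 < p j) (hs : Summable p) {x₀ ε : ℝ} (hε : 0 ≤ ε) (hε2 : ε ≤ 1 / 2)
    (h : ∀ x, 0 < x → x ≤ x₀ → nubar p (x / 2) ≤ (1 + ε) * nubar p x) :
    ∀ x, 0 < x → x ≤ x₀ → (∑' j, if p j < x then p j else 0) ≤ 4 * ε * (x * nubar p x) := by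
  intro x hx hx0
  have hN : 0 ≤ nubar p x := Nat.cast_nonneg _
  have := (s_tendsto hpos hs x).const_add (4 * ε * (x * nubar p x))
  rw [add_zero] at this
  refine ge_of_tendsto' this fun n => ?_
  refine (B4n hpos hs hε hε2 h n x hx hx0).trans ?_
  have : 0 ≤ (3 / 4 : ℝ) ^ n := by positivity
  have h1 : 4 * ε * (1 - (3 / 4) ^ n) ≤ 4 * ε := by nlinarith
  have h2 := mul_le_mul_of_nonneg_right h1 (mul_nonneg hx.le hN)
  linarith

lemma lim_exp : Tendsto (fun M : ℝ => 1 - Real.exp (-M)) atTop (𝓝 1) := by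
  have := Real.tendsto_exp_neg_atTop_nhds_zero.const_sub 1
  simpa using this

lemma phi_to_nu (hpos : ∀ j, 0 < p j) (hs : Summable p) {ℓ : ℝ → ℝ}
    (hℓ : ∀ y : ℝ, 0 < y → 0 < ℓ y) (hsv : SlowlyVarying ℓ)
    (h : Tendsto (fun t : ℝ => Phi p t / ℓ t) atTop (𝓝 1)) :
    Tendsto (fun t : ℝ => nubar p (1 / t) / ℓ t) atTop (𝓝 1) := by
  rw [tendsto_order]
  constructor
  · intro a ha
    have h2 := sv_shift hℓ hsv h 2 (by norm_num)
    have h3 := h.sub ((h2.sub h).const_mul (Real.exp 1))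
    rw [sub_self, mul_zero, sub_zero] at h3
    filter_upwards [h3.eventually (lt_mem_nhds ha), eventually_gt_atTop 0] with t h4 ht
    refine h4.trans_le ?_
    have := B2 hpos hs ht
    have hl := hℓ t ht
    rw [← sub_div, ← mul_div_assoc, ← sub_div]
    gcongr
    linarith
  · intro b hb
    have := lim_exp.inv₀ one_ne_zero
    rw [inv_one] at this
    obtain ⟨M, hM, hM0⟩ := ((this.eventually (gt_mem_nhds hb)).and (eventually_gt_atTop 0)).exists
    have h2 := (sv_shift hℓ hsv h M hM0).const_mul ((1 - Real.exp (-M))⁻¹)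
    rw [mul_one] at h2
    have hp : 0 < 1 - Real.exp (-M) := by
      have : Real.exp (-M) < 1 := Real.exp_lt_one_iff.2 (by linarith)
      linarith
    filter_upwards [h2.eventually (gt_mem_nhds hM), eventually_gt_atTop 0] with t h4 ht
    refine lt_of_le_of_lt ?_ h4
    have := B1 hpos hs (t := M * t) (M := M) (by positivity) hM0
    have e : M / (M * t) = 1 / t := by field_simp
    rw [e] at this
    have hl := hℓ t ht
    rw [← mul_div_assoc]
    gcongr
    rw [le_inv_mul_iff₀ hp]
    exact this

lemma nu_to_phi (hpos : ∀ j, 0 < p j) (hs : Summable p) {ℓ : ℝ → ℝ}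
    (hℓ : ∀ y : ℝ, 0 < y → 0 < ℓ y) (hsv : SlowlyVarying ℓ)
    (h : Tendsto (fun t : ℝ => nubar p (1 / t) / ℓ t) atTop (𝓝 1)) :
    Tendsto (fun t : ℝ => Phi p t / ℓ t) atTop (𝓝 1) := by
  rw [tendsto_order]
  constructor
  · intro a ha
    obtain ⟨M, hM, hM0⟩ := ((lim_exp.eventually (lt_mem_nhds ha)).and (eventually_gt_atTop 0)).exists
    have h2 := (sv_shift (F := fun t => nubar p (1 / t)) hℓ hsv h M⁻¹ (by positivity)).const_mul
      (1 - Real.exp (-M))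
    rw [mul_one] at h2
    filter_upwards [h2.eventually (lt_mem_nhds hM), eventually_gt_atTop 0] with t h4 ht
    refine h4.trans_le ?_
    have := B1 hpos hs ht hM0
    have e : 1 / (M⁻¹ * t) = M / t := by field_simp
    rw [e]
    have hl := hℓ t ht
    rw [← mul_div_assoc]
    gcongr
  · intro b hb
    obtain ⟨ε, hε, hε2, hb2⟩ : ∃ ε : ℝ, 0 < ε ∧ ε ≤ 1 / 2 ∧ 1 + 4 * ε < b := by
      refine ⟨min (1 / 2) ((b - 1) / 8), lt_min (by norm_num) (by linarith), min_le_left _ _, ?_⟩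
      have := min_le_right (1 / 2) ((b - 1) / 8)
      linarith
    have h2 := sv_shift (F := fun t => nubar p (1 / t)) hℓ hsv h 2 (by norm_num)
    have h3 := h2.div h one_ne_zero
    rw [div_one] at h3
    have ev := (h3.eventually (gt_mem_nhds (show 1 < 1 + ε by linarith))).and
      ((h.eventually (lt_mem_nhds (show (0:ℝ) < 1 by norm_num))).and (eventually_gt_atTop 0))
    obtain ⟨T, hT⟩ := eventually_atTop.1 ev
    have hT0 : 0 < T := (hT T le_rfl).2.2
    have key : ∀ x, 0 < x → x ≤ 1 / T → nubar p (x / 2) ≤ (1 + ε) * nubar p x := by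
      intro x hx hxT
      obtain ⟨k1, k2, k3⟩ := hT (1 / x) (by rw [le_div_iff₀ hx]; rwa [le_div_iff₀ hT0, mul_comm] at hxT)
      have hl := hℓ _ k3
      have e1 : 1 / (2 * (1 / x)) = x / 2 := by field_simp
      simp only [Pi.div_apply, e1, one_div_one_div] at k1 k2
      have hN : 0 < nubar p x := by
        by_contra hc
        exact absurd k2 (not_lt.2 (div_nonpos_of_nonpos_of_nonneg (not_lt.1 hc) hl.le))
      rw [div_div_div_cancel_right₀ hl.ne', div_lt_iff₀ hN] at k1
      exact k1.le
    have h5 := h.const_mul (1 + 4 * ε)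
    rw [mul_one] at h5
    filter_upwards [h5.eventually (gt_mem_nhds hb2), eventually_ge_atTop T] with t h6 htT
    refine lt_of_le_of_lt ?_ h6
    have ht : 0 < t := hT0.trans_le htT
    have hl := hℓ t ht
    have l1 := B3 hpos hs ht
    have l2 := B4lim hpos hs hε.le hε2 key (1 / t) (by positivity) (by gcongr)
    rw [← mul_div_assoc]
    gcongr
    refine l1.trans ?_
    calc _ ≤ nubar p (1 / t) + t * (4 * ε * (1 / t * nubar p (1 / t))) := by gcongr
      _ = _ := by field_simp

lemma pow_exp_bound (n : ℕ) {x : ℝ} (hx : 0 ≤ x) :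
    x ^ (n + 1) * Real.exp (-x) ≤ (4 * 2 ^ n * n.factorial) *
      (Real.exp (-(x / 4)) - Real.exp (-(x / 2))) := by
  have h1 : (x / 2) ^ n / n.factorial ≤ Real.exp (x / 2) :=
    Real.pow_div_factorial_le_exp (x / 2) (by positivity) n
  have hf : (0:ℝ) < n.factorial := by positivity
  rw [div_le_iff₀ hf, div_pow, div_le_iff₀ (by positivity)] at h1
  have h2 : x / 4 * Real.exp (-(x / 2)) ≤ Real.exp (-(x / 4)) - Real.exp (-(x / 2)) := by
    have a := Real.add_one_le_exp (x / 4)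
    have b : Real.exp (-(x / 4)) = Real.exp (x / 4) * Real.exp (-(x / 2)) := by
      rw [← Real.exp_add]; ring_nf
    have c := Real.exp_pos (-(x / 2))
    rw [b]; nlinarith
  have h3 : Real.exp (-x) * Real.exp (x / 2) = Real.exp (-(x / 2)) := by
    rw [← Real.exp_add]; ring_nf
  calc x ^ (n + 1) * Real.exp (-x) = x * (x ^ n * Real.exp (-x)) := by ring
    _ ≤ x * ((Real.exp (x / 2) * n.factorial * 2 ^ n) * Real.exp (-x)) := by gcongr
    _ = (4 * 2 ^ n * n.factorial) * (x / 4 * Real.exp (-(x / 2))) := by rw [← h3]; ring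
    _ ≤ _ := by gcongr

lemma phir_summable (hpos : ∀ j, 0 < p j) (hs : Summable p) (n : ℕ) {t : ℝ} (ht : 0 < t) :
    Summable (fun j => p j * ((t * p j) ^ n * Real.exp (-t * p j))) := by
  refine Summable.of_nonneg_of_le (fun j => ?_) (fun j => ?_) (hs.mul_right (n.factorial : ℝ))
  · have := hpos j
    positivity
  · have hp := hpos j
    have : (t * p j) ^ n / n.factorial ≤ Real.exp (t * p j) :=
      Real.pow_div_factorial_le_exp _ (by positivity) n
    rw [div_le_iff₀ (by positivity)] at this
    gcongr
    rw [neg_mul, Real.exp_neg, ← div_eq_mul_inv, div_le_iff₀ (Real.exp_pos _)]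
    linarith

lemma phiR_eq (n : ℕ) (t : ℝ) :
    PhiR p (n + 1) t = t * (∑' j, p j * ((t * p j) ^ n * Real.exp (-t * p j))) /
      (n + 1).factorial := by
  rw [PhiR, ← tsum_mul_left, ← tsum_mul_left, ← tsum_div_const]
  congr 1; ext j
  ring

lemma phir_o (hpos : ∀ j, 0 < p j) (hs : Summable p) {ℓ : ℝ → ℝ}
    (hℓ : ∀ y : ℝ, 0 < y → 0 < ℓ y) (hsv : SlowlyVarying ℓ)
    (h : Tendsto (fun t : ℝ => Phi p t / ℓ t) atTop (𝓝 1)) (r : ℕ) (hr : 1 ≤ r) :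
    Tendsto (fun t : ℝ => PhiR p r t / Phi p t) atTop (𝓝 0) := by
  obtain ⟨n, rfl⟩ : ∃ n, r = n + 1 := ⟨r - 1, by omega⟩
  have key : ∀ t, 0 < t → PhiR p (n + 1) t ≤
      (4 * 2 ^ n * n.factorial) * (Phi p (1 / 2 * t) - Phi p (1 / 4 * t)) := by
    intro t ht
    have s2 := phi_summable hpos hs (t := 1 / 2 * t) (by positivity)
    have s4 := phi_summable hpos hs (t := 1 / 4 * t) (by positivity)
    rw [phiR_eq, Phi, Phi, ← s2.tsum_sub s4]
    have s := (phir_summable hpos hs n ht)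
    have hpn : 0 ≤ ∑' j, p j * ((t * p j) ^ n * Real.exp (-t * p j)) :=
      tsum_nonneg fun j => by have := hpos j; positivity
    have hf1 : (1:ℝ) ≤ ((n + 1).factorial : ℝ) := by
      exact_mod_cast Nat.one_le_iff_ne_zero.2 (Nat.factorial_ne_zero _)
    refine (div_le_self (mul_nonneg ht.le hpn) hf1).trans ?_
    rw [← tsum_mul_left, ← tsum_mul_left]
    refine Summable.tsum_le_tsum (fun j => ?_) (s.mul_left t) ((s2.sub s4).mul_left _)
    have hp := hpos j
    have := pow_exp_bound n (x := t * p j) (by positivity)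
    have e1 : t * (p j * ((t * p j) ^ n * Real.exp (-t * p j))) =
        (t * p j) ^ (n + 1) * Real.exp (-(t * p j)) := by rw [pow_succ, neg_mul]; ring
    have e2 : -(1 / 2 * t) * p j = -(t * p j / 2) := by ring
    have e3 : -(1 / 4 * t) * p j = -(t * p j / 4) := by ring
    rw [e1, e2, e3]
    refine this.trans (le_of_eq ?_)
    ring
  have h2 := sv_shift hℓ hsv h (1 / 2) (by norm_num)
  have h4 := sv_shift hℓ hsv h (1 / 4) (by norm_num)
  have h5 := ((h2.sub h4).const_mul (4 * 2 ^ n * n.factorial : ℝ)).div h one_ne_zero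
  rw [sub_self, mul_zero, zero_div] at h5
  have ev : ∀ᶠ t in atTop, 0 < t ∧ 0 < Phi p t := by
    filter_upwards [h.eventually (lt_mem_nhds (show (0:ℝ) < 1 by norm_num)),
      eventually_gt_atTop 0] with t k1 k2
    refine ⟨k2, ?_⟩
    by_contra hc
    exact absurd k1 (not_lt.2 (div_nonpos_of_nonpos_of_nonneg (not_lt.1 hc) (hℓ t k2).le))
  refine tendsto_of_tendsto_of_tendsto_of_le_of_le' tendsto_const_nhds h5 ?_ ?_
  · filter_upwards [ev] with t ⟨ht, hp⟩
    have : 0 ≤ ∑' j, p j ^ (n+1) * Real.exp (-t * p j) :=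
      tsum_nonneg fun j => by have := hpos j; positivity
    unfold PhiR; positivity
  · filter_upwards [ev] with t ⟨ht, hp⟩
    have hl := hℓ t ht
    simp only [Pi.div_apply]
    rw [← sub_div, ← mul_div_assoc, div_div_div_cancel_right₀ hl.ne']
    gcongr
    exact key t ht

lemma nu_summable (hpos : ∀ j, 0 < p j) (hs : Summable p) (x : ℝ) :
    Summable (fun j => if p j ≤ x then p j else 0) := by
  refine Summable.of_nonneg_of_le (fun j => ?_) (fun j => ?_) hs
  · split_ifs
    exacts [(hpos j).le, le_rfl]
  · split_ifs
    exacts [le_rfl, (hpos j).le]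

lemma nu_mono (hpos : ∀ j, 0 < p j) (hs : Summable p) : Monotone (nuOne p) := by
  intro x y hxy
  refine Summable.tsum_le_tsum (fun j => ?_) (nu_summable hpos hs x) (nu_summable hpos hs y)
  have := hpos j
  split_ifs <;> linarith

lemma nu_pos (hpos : ∀ j, 0 < p j) (hs : Summable p) {x : ℝ} (hx : 0 < x) : 0 < nuOne p x := by
  obtain ⟨j, hj⟩ := (hs.tendsto_atTop_zero.eventually (gt_mem_nhds hx)).exists
  refine (nu_summable hpos hs x).tsum_pos (fun i => ?_) j ?_
  · split_ifs
    exacts [(hpos i).le, le_rfl]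
  · rw [if_pos hj.le]; exact hpos j

lemma nu_le (hpos : ∀ j, 0 < p j) (hs : Summable p) (x : ℝ) : nuOne p x ≤ ∑' j, p j := by
  refine Summable.tsum_le_tsum (fun j => ?_) (nu_summable hpos hs x) hs
  have := hpos j
  split_ifs <;> linarith

lemma powexp_int (k : ℕ) : IntegrableOn (fun u : ℝ => u ^ k * Real.exp (-u)) (Set.Ioi 0) := by
  have := Real.GammaIntegral_convergent (s := (k:ℝ) + 1) (by positivity)
  simpa [mul_comm] using this

lemma powexp_val (k : ℕ) : ∫ u in Set.Ioi (0:ℝ), u ^ k * Real.exp (-u) = k.factorial := by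
  have := Real.Gamma_eq_integral (s := (k:ℝ) + 1) (by positivity)
  rw [Real.Gamma_nat_eq_factorial] at this
  rw [this]
  simp [mul_comm]

lemma polyexp_int (P : Polynomial ℝ) :
    IntegrableOn (fun u : ℝ => P.eval u * Real.exp (-u)) (Set.Ioi 0) := by
  induction P using Polynomial.induction_on' with
  | add P Q hP hQ =>
    have := hP.add hQ
    refine this.congr_fun (fun u _ => ?_) measurableSet_Ioi
    simp [add_mul]
  | monomial k a =>
    have : IntegrableOn (fun u : ℝ => a * (u ^ k * Real.exp (-u))) (Set.Ioi 0) :=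
      (powexp_int k).const_mul a
    refine this.congr_fun (fun u _ => ?_) measurableSet_Ioi
    simp [mul_assoc]

lemma w_int (n : ℕ) : IntegrableOn (fun u : ℝ => (u ^ n - n * u ^ (n - 1)) * Real.exp (-u))
    (Set.Ioi 0) := by
  have := polyexp_int (Polynomial.X ^ n - Polynomial.C (n:ℝ) * Polynomial.X ^ (n - 1))
  simpa using this

lemma w_tail (n : ℕ) {y : ℝ} (hy : 0 ≤ y) :
    ∫ u in Set.Ioi y, (u ^ n - n * u ^ (n - 1)) * Real.exp (-u) = y ^ n * Real.exp (-y) := by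
  have hd : ∀ x : ℝ, HasDerivAt (fun u : ℝ => -(u ^ n * Real.exp (-u)))
      ((x ^ n - n * x ^ (n - 1)) * Real.exp (-x)) x := by
    intro x
    have := ((hasDerivAt_pow n x).mul ((hasDerivAt_neg x).exp)).neg
    refine this.congr_deriv ?_
    simp; ring
  have := integral_Ioi_of_hasDerivAt_of_tendsto (a := y) (hd y).continuousAt.continuousWithinAt
    (fun x _ => hd x) ((w_int n).mono_set (Set.Ioi_subset_Ioi hy))
    (Real.tendsto_pow_mul_exp_neg_atTop_nhds_zero n).neg
  rw [this]; simp

lemma w_u (n : ℕ) :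
    ∫ u in Set.Ioi (0:ℝ), (u ^ n - n * u ^ (n - 1)) * Real.exp (-u) * u = n.factorial := by
  have e : ∀ u : ℝ, (u ^ n - n * u ^ (n - 1)) * Real.exp (-u) * u =
      u ^ (n + 1) * Real.exp (-u) - n * (u ^ n * Real.exp (-u)) := by
    intro u
    cases n with
    | zero => simp; ring
    | succ n => simp; ring
  simp_rw [e]
  rw [integral_sub (powexp_int _) ((powexp_int _).const_mul _), integral_const_mul, powexp_val,
    powexp_val, Nat.factorial_succ]
  push_cast; ring

lemma swap (hpos : ∀ j, 0 < p j) (hs : Summable p) (n : ℕ) {t : ℝ} (ht : 0 < t) :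
    ∑' j, p j * ((t * p j) ^ n * Real.exp (-t * p j)) =
      ∫ u in Set.Ioi (0:ℝ), (u ^ n - n * u ^ (n - 1)) * Real.exp (-u) * nuOne p (u / t) := by
  set w : ℝ → ℝ := fun u => (u ^ n - n * u ^ (n - 1)) * Real.exp (-u) with hw
  let F : ℕ → ℝ → ℝ := fun j => (Set.Ici (t * p j)).indicator (fun u => w u * p j)
  have hF : ∀ j, Integrable (F j) (volume.restrict (Set.Ioi 0)) := fun j =>
    ((w_int n).mul_const (p j)).indicator measurableSet_Ici
  have hFs : Summable fun j => ∫ u in Set.Ioi (0:ℝ), ‖F j u‖ := by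
    refine Summable.of_nonneg_of_le (fun j => integral_nonneg fun u => norm_nonneg _) (fun j => ?_)
      (hs.mul_left (∫ u in Set.Ioi (0:ℝ), ‖w u‖))
    rw [← integral_mul_const]
    refine integral_mono (hF j).norm ((w_int n).norm.mul_const _) fun u => ?_
    refine (norm_indicator_le_norm_self _ _).trans ?_
    simp [abs_of_pos (hpos j)]
  have key := (hasSum_integral_of_summable_integral_norm hF hFs).tsum_eq
  have e1 : ∀ j, ∫ u in Set.Ioi (0:ℝ), F j u = p j * ((t * p j) ^ n * Real.exp (-t * p j)) := by
    intro j
    have hp := hpos j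
    have hy : 0 < t * p j := by positivity
    simp only [F]
    rw [setIntegral_indicator measurableSet_Ici]
    have : Set.Ioi 0 ∩ Set.Ici (t * p j) = Set.Ici (t * p j) := by
      apply Set.inter_eq_right.2
      intro u hu
      exact lt_of_lt_of_le hy hu
    rw [this, integral_Ici_eq_integral_Ioi, integral_mul_const, w_tail n hy.le]
    rw [neg_mul]; ring
  simp_rw [e1] at key
  rw [key]
  refine integral_congr_ae (Eventually.of_forall fun u => ?_)
  simp only [nuOne, F]
  rw [← tsum_mul_left]
  congr 1; ext j
  by_cases h : p j ≤ u / t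
  · have : u ∈ Set.Ici (t * p j) := by
      rw [le_div_iff₀ ht] at h; simp; linarith
    rw [Set.indicator_of_mem this, if_pos h]
  · have : u ∉ Set.Ici (t * p j) := by
      rw [le_div_iff₀ ht] at h; simp; linarith
    rw [Set.indicator_of_notMem this, if_neg h, mul_zero]

lemma nu_double (hpos : ∀ j, 0 < p j) (hs : Summable p) {ℓ : ℝ → ℝ}
    (hℓ : ∀ y : ℝ, 0 < y → 0 < ℓ y) (hsv : SlowlyVarying ℓ)
    (h : Tendsto (fun t : ℝ => t * nuOne p (1 / t) / ℓ t) atTop (𝓝 1)) :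
    ∃ m : ℕ, ∀ x, 0 < x → nuOne p (2 * x) ≤ 2 ^ m * nuOne p x := by
  have h2 := (sv_shift (F := fun t => t * nuOne p (1 / t)) hℓ hsv h (1 / 2) (by norm_num)).div h
    one_ne_zero
  rw [div_one] at h2
  obtain ⟨T, hT⟩ := eventually_atTop.1 ((h2.eventually (gt_mem_nhds (show (1:ℝ) < 2 by norm_num))).and
    (eventually_gt_atTop 0))
  have hT0 : 0 < T := (hT T le_rfl).2
  have hn0 := nu_pos hpos hs (x := 1 / T) (by positivity)
  obtain ⟨m, hm⟩ := pow_unbounded_of_one_lt (max 4 ((∑' j, p j) / nuOne p (1 / T)))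
    (show (1:ℝ) < 2 by norm_num)
  refine ⟨m, fun x hx => ?_⟩
  have hn := nu_pos hpos hs hx
  by_cases hc : x ≤ 1 / T
  · obtain ⟨k1, k2⟩ := hT (1 / x) (by rw [le_div_iff₀ hx]; rwa [le_div_iff₀ hT0, mul_comm] at hc)
    have hl := hℓ _ k2
    have e1 : 1 / (1 / 2 * (1 / x)) = 2 * x := by field_simp
    simp only [Pi.div_apply, e1, one_div_one_div] at k1
    rw [div_div_div_cancel_right₀ hl.ne', div_lt_iff₀ (by positivity)] at k1
    have k3 : nuOne p (2 * x) < 4 * nuOne p x := by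
      have e : 1 / 2 * (1 / x) * nuOne p (2 * x) = 1 / x * (1 / 2 * nuOne p (2 * x)) := by ring
      have e' : 2 * (1 / x * nuOne p x) = 1 / x * (2 * nuOne p x) := by ring
      rw [e, e', mul_lt_mul_iff_right₀ k2] at k1
      linarith
    have : (4:ℝ) ≤ 2 ^ m := (le_max_left _ _).trans hm.le
    nlinarith
  · have h1 : (∑' j, p j) / nuOne p (1 / T) ≤ 2 ^ m := (le_max_right _ _).trans hm.le
    rw [div_le_iff₀ hn0] at h1
    refine (nu_le hpos hs _).trans (h1.trans ?_)
    gcongr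
    exact nu_mono hpos hs (not_le.1 hc).le

lemma nu_pot (hpos : ∀ j, 0 < p j) (hs : Summable p) {m : ℕ}
    (h : ∀ x, 0 < x → nuOne p (2 * x) ≤ 2 ^ m * nuOne p x) {u x : ℝ} (hu : 0 < u) (hx : 0 < x) :
    nuOne p (u * x) ≤ (1 + (2 * u) ^ m) * nuOne p x := by
  have hn := nu_pos hpos hs hx
  by_cases h1 : 1 ≤ u
  · obtain ⟨k, hk1, hk2⟩ := exists_nat_pow_near h1 (show (1:ℝ) < 2 by norm_num)
    have it : ∀ k : ℕ, nuOne p (2 ^ k * x) ≤ (2 ^ m) ^ k * nuOne p x := by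
      intro k
      induction k with
      | zero => simp
      | succ k ih =>
        have := h (2 ^ k * x) (by positivity)
        rw [← mul_assoc, ← pow_succ'] at this
        refine this.trans ?_
        rw [pow_succ (2 ^ m), mul_comm ((2 ^ m) ^ k), mul_assoc]
        gcongr
    calc nuOne p (u * x) ≤ nuOne p (2 ^ (k + 1) * x) := nu_mono hpos hs (by gcongr)
      _ ≤ (2 ^ m) ^ (k + 1) * nuOne p x := it _
      _ = (2 * 2 ^ k) ^ m * nuOne p x := by rw [← pow_mul, ← pow_succ', ← pow_mul, mul_comm m]
      _ ≤ (2 * u) ^ m * nuOne p x := by gcongr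
      _ ≤ _ := by linarith
  · have a : nuOne p (u * x) ≤ nuOne p x := nu_mono hpos hs (by nlinarith)
    have : 0 ≤ (2 * u) ^ m * nuOne p x := by positivity
    linarith

lemma abel (hpos : ∀ j, 0 < p j) (hs : Summable p) {ℓ : ℝ → ℝ}
    (hℓ : ∀ y : ℝ, 0 < y → 0 < ℓ y) (hsv : SlowlyVarying ℓ)
    (h : Tendsto (fun t : ℝ => t * nuOne p (1 / t) / ℓ t) atTop (𝓝 1)) (n : ℕ) :
    Tendsto (fun t : ℝ => t * (∑' j, p j * ((t * p j) ^ n * Real.exp (-t * p j))) / ℓ t) atTop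
      (𝓝 n.factorial) := by
  obtain ⟨m, hm⟩ := nu_double hpos hs hℓ hsv h
  rw [← w_u n]
  set w : ℝ → ℝ := fun u => (u ^ n - n * u ^ (n - 1)) * Real.exp (-u) with hw
  have main : Tendsto (fun t : ℝ => ∫ u in Set.Ioi (0:ℝ), w u * (t * nuOne p (u / t) / ℓ t)) atTop
      (𝓝 (∫ u in Set.Ioi (0:ℝ), w u * u)) := by
    refine tendsto_integral_filter_of_dominated_convergence
      (fun u => (u ^ n + n * u ^ (n - 1)) * (1 + (2 * u) ^ m) * 2 * Real.exp (-u)) ?_ ?_ ?_ ?_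
    · filter_upwards [eventually_gt_atTop 0] with t ht
      have mm : Measurable (fun u => nuOne p (u / t)) :=
        (nu_mono hpos hs).measurable.comp (measurable_id.div_const t)
      have mw : Measurable w := by fun_prop
      exact (mw.mul ((mm.const_mul t).div_const _)).aestronglyMeasurable
    · filter_upwards [eventually_gt_atTop 0, h.eventually (gt_mem_nhds (show (1:ℝ) < 2 by norm_num))]
        with t ht h2
      filter_upwards [ae_restrict_mem measurableSet_Ioi] with u hu
      have hu : 0 < u := hu
      have hl := hℓ t ht
      have b1 := nu_pot hpos hs hm hu (show 0 < 1 / t by positivity)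
      rw [mul_one_div] at b1
      have n0 := nu_pos hpos hs (x := u / t) (by positivity)
      rw [norm_mul, Real.norm_of_nonneg (r := t * nuOne p (u / t) / ℓ t) (by positivity)]
      have b2 : ‖w u‖ ≤ (u ^ n + n * u ^ (n - 1)) * Real.exp (-u) := by
        rw [hw, norm_mul, Real.norm_of_nonneg (Real.exp_pos _).le]
        gcongr
        refine (norm_sub_le _ _).trans (le_of_eq ?_)
        rw [Real.norm_of_nonneg (by positivity), Real.norm_of_nonneg (by positivity)]
      have b3 : t * nuOne p (u / t) / ℓ t ≤ (1 + (2 * u) ^ m) * 2 := by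
        calc t * nuOne p (u / t) / ℓ t ≤ t * ((1 + (2 * u) ^ m) * nuOne p (1 / t)) / ℓ t := by gcongr
          _ = (1 + (2 * u) ^ m) * (t * nuOne p (1 / t) / ℓ t) := by ring
          _ ≤ _ := by gcongr
      calc _ ≤ ((u ^ n + n * u ^ (n - 1)) * Real.exp (-u)) * ((1 + (2 * u) ^ m) * 2) := by gcongr
        _ = _ := by ring
    · have := polyexp_int ((Polynomial.X ^ n + Polynomial.C (n:ℝ) * Polynomial.X ^ (n - 1)) *
        (1 + (Polynomial.C 2 * Polynomial.X) ^ m) * Polynomial.C 2)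
      simp only [Polynomial.eval_mul, Polynomial.eval_add, Polynomial.eval_pow, Polynomial.eval_X,
        Polynomial.eval_C, Polynomial.eval_one] at this
      exact this
    · filter_upwards [ae_restrict_mem measurableSet_Ioi] with u hu
      have hu : 0 < u := hu
      refine Tendsto.const_mul _ ?_
      have := (sv_shift (F := fun t => t * nuOne p (1 / t)) hℓ hsv h u⁻¹ (by positivity)).const_mul u
      rw [mul_one] at this
      refine this.congr' ?_
      filter_upwards [eventually_gt_atTop 0] with t ht
      have e : 1 / (u⁻¹ * t) = u / t := by field_simp
      rw [e]
      field_simp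
  refine main.congr' ?_
  filter_upwards [eventually_gt_atTop 0] with t ht
  rw [swap hpos hs n ht, mul_div_right_comm, ← integral_const_mul]
  congr 1; ext u
  simp only [hw]; ring

lemma exp_mem (hpos : ∀ j, 0 < p j) {t : ℝ} (ht : 0 < t) (j : ℕ) :
    Real.exp (-t * p j) ∈ Set.Icc (0:ℝ) 1 :=
  ⟨(Real.exp_pos _).le, Real.exp_le_one_iff.2 (by nlinarith [mul_pos ht (hpos j)])⟩

lemma W_summable (hpos : ∀ j, 0 < p j) (hs : Summable p) {g : ℝ → ℝ}
    (hg : ContinuousOn g (Set.Icc 0 1)) {t : ℝ} (ht : 0 < t) :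
    Summable (fun j => p j * (Real.exp (-t * p j) * g (Real.exp (-t * p j)))) := by
  obtain ⟨C, hC⟩ := isCompact_Icc.exists_bound_of_continuousOn hg
  refine Summable.of_norm_bounded (hs.mul_right C) fun j => ?_
  have hm := exp_mem hpos ht j
  have := hC _ hm
  rw [norm_mul, norm_mul, Real.norm_of_nonneg (hpos j).le, Real.norm_of_nonneg hm.1]
  have hp := hpos j
  gcongr
  calc _ ≤ 1 * C := by gcongr; exact hm.2
    _ = C := one_mul C

lemma W_poly (hpos : ∀ j, 0 < p j) (hs : Summable p) {ℓ : ℝ → ℝ}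
    (hℓ : ∀ y : ℝ, 0 < y → 0 < ℓ y) (hsv : SlowlyVarying ℓ)
    (h : Tendsto (fun t : ℝ => t * (∑' j, p j * Real.exp (-t * p j)) / ℓ t) atTop (𝓝 1))
    (P : Polynomial ℝ) :
    Tendsto (fun t : ℝ => t * (∑' j, p j * (Real.exp (-t * p j) * P.eval (Real.exp (-t * p j)))) / ℓ t)
      atTop (𝓝 (∫ x in (0:ℝ)..1, P.eval x)) := by
  induction P using Polynomial.induction_on' with
  | add P Q hP hQ =>
    have := hP.add hQ
    have e : ∫ x in (0:ℝ)..1, (P + Q).eval x =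
        (∫ x in (0:ℝ)..1, P.eval x) + ∫ x in (0:ℝ)..1, Q.eval x := by
      simp_rw [Polynomial.eval_add]
      exact intervalIntegral.integral_add (P.continuous.intervalIntegrable _ _)
        (Q.continuous.intervalIntegrable _ _)
    rw [e]
    refine this.congr' ?_
    filter_upwards [eventually_gt_atTop 0] with t ht
    rw [← add_div, ← mul_add, ← (W_summable hpos hs P.continuous.continuousOn ht).tsum_add
      (W_summable hpos hs Q.continuous.continuousOn ht)]
    congr 3; ext j
    simp; ring
  | monomial k a =>
    have h1 := (sv_shift (F := fun t => t * (∑' j, p j * Real.exp (-t * p j))) hℓ hsv h (k + 1)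
      (by positivity)).const_mul (a / (k + 1))
    have e : ∫ x in (0:ℝ)..1, (Polynomial.monomial k a).eval x = a / (k + 1) * 1 := by
      simp_rw [Polynomial.eval_monomial]
      rw [intervalIntegral.integral_const_mul, integral_pow]
      simp; ring
    rw [e]
    refine h1.congr' ?_
    filter_upwards [eventually_gt_atTop 0] with t ht
    have e2 : ∀ j, p j * (Real.exp (-t * p j) * (Polynomial.monomial k a).eval (Real.exp (-t * p j)))
        = a * (p j * Real.exp (-((k + 1) * t) * p j)) := by
      intro j
      rw [Polynomial.eval_monomial, ← Real.exp_nat_mul]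
      have : Real.exp (-((k + 1) * t) * p j) = Real.exp (-t * p j) * Real.exp (k * (-t * p j)) := by
        rw [← Real.exp_add]; ring_nf
      rw [this]; ring
    simp_rw [e2]
    rw [tsum_mul_left]
    have : (k:ℝ) + 1 ≠ 0 := by positivity
    field_simp

lemma W_cont (hpos : ∀ j, 0 < p j) (hs : Summable p) {ℓ : ℝ → ℝ}
    (hℓ : ∀ y : ℝ, 0 < y → 0 < ℓ y) (hsv : SlowlyVarying ℓ)
    (h : Tendsto (fun t : ℝ => t * (∑' j, p j * Real.exp (-t * p j)) / ℓ t) atTop (𝓝 1))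
    (g : ℝ → ℝ) (hg : Continuous g) :
    Tendsto (fun t : ℝ => t * (∑' j, p j * (Real.exp (-t * p j) * g (Real.exp (-t * p j)))) / ℓ t)
      atTop (𝓝 (∫ x in (0:ℝ)..1, g x)) := by
  rw [Metric.tendsto_nhds]
  intro δ hδ
  set ε := δ / 5 with hε
  have hε0 : 0 < ε := by positivity
  obtain ⟨P, hP⟩ := exists_polynomial_near_of_continuousOn 0 1 g hg.continuousOn ε hε0
  have h1 := Metric.tendsto_nhds.1 (W_poly hpos hs hℓ hsv h P) ε hε0
  have hI : |(∫ x in (0:ℝ)..1, P.eval x) - ∫ x in (0:ℝ)..1, g x| ≤ ε := by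
    rw [← intervalIntegral.integral_sub (P.continuous.intervalIntegrable _ _)
      (hg.intervalIntegrable _ _)]
    have := intervalIntegral.norm_integral_le_of_norm_le_const (a := 0) (b := 1) (C := ε)
      (f := fun x => P.eval x - g x) (fun x hx => by
        rw [Set.uIoc_of_le zero_le_one] at hx
        exact (hP x ⟨hx.1.le, hx.2⟩).le)
    simpa using this
  filter_upwards [h1, h.eventually (gt_mem_nhds (show (1:ℝ) < 2 by norm_num)),
    eventually_gt_atTop 0] with t k1 k2 ht
  have hl := hℓ t ht
  have sP := W_summable hpos hs P.continuous.continuousOn ht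
  have sg := W_summable hpos hs hg.continuousOn ht
  have s1 := W_summable hpos hs (g := fun _ => 1) continuousOn_const ht
  simp only [mul_one] at s1
  have d : |(∑' j, p j * (Real.exp (-t * p j) * P.eval (Real.exp (-t * p j)))) -
      ∑' j, p j * (Real.exp (-t * p j) * g (Real.exp (-t * p j)))| ≤
      ε * ∑' j, p j * Real.exp (-t * p j) := by
    rw [← sP.tsum_sub sg, ← tsum_mul_left]
    rw [← Real.norm_eq_abs]
    refine tsum_of_norm_bounded (s1.mul_left ε).hasSum fun j => ?_
    have hm := exp_mem hpos ht j
    have := (hP _ hm).le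
    have hp := hpos j
    rw [← mul_sub, ← mul_sub, norm_mul, norm_mul, Real.norm_of_nonneg hp.le,
      Real.norm_of_nonneg hm.1, Real.norm_eq_abs]
    calc _ ≤ p j * (Real.exp (-t * p j) * ε) := by gcongr
      _ = _ := by ring
  rw [Real.dist_eq] at k1 ⊢
  have d2 : |t * (∑' j, p j * (Real.exp (-t * p j) * P.eval (Real.exp (-t * p j)))) / ℓ t -
      t * (∑' j, p j * (Real.exp (-t * p j) * g (Real.exp (-t * p j)))) / ℓ t| ≤ 2 * ε := by
    rw [← sub_div, ← mul_sub, abs_div, abs_mul, abs_of_pos ht, abs_of_pos hl]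
    calc _ ≤ t * (ε * ∑' j, p j * Real.exp (-t * p j)) / ℓ t := by gcongr
      _ = ε * (t * (∑' j, p j * Real.exp (-t * p j)) / ℓ t) := by ring
      _ ≤ ε * 2 := by gcongr
      _ = _ := by ring
  rw [abs_le] at d2 hI
  rw [abs_lt] at k1 ⊢
  constructor <;> linarith [d2.1, d2.2, hI.1, hI.2, k1.1, k1.2]

lemma exists_trap {a b : ℝ} (ha : 0 < a) (hab : a < b) : ∃ g : ℝ → ℝ, Continuous g ∧
    (∀ x, Real.exp (-a) ≤ x → x * g x = 1) ∧ (∀ x, 0 ≤ x → x < Real.exp (-b) → g x = 0) ∧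
    (∀ x, 0 ≤ x → 0 ≤ g x ∧ x * g x ≤ 1) := by
  set α := Real.exp (-b)
  set β := Real.exp (-a)
  have hα : 0 < α := Real.exp_pos _
  have hαβ : α < β := Real.exp_lt_exp.2 (by linarith)
  have hM : ∀ x, 0 < max x α := fun x => hα.trans_le (le_max_right _ _)
  refine ⟨fun x => max 0 (min 1 ((x - α) / (β - α))) / max x α, ?_, ?_, ?_, ?_⟩
  · refine Continuous.div (by fun_prop) (by fun_prop) fun x => (hM x).ne'
  · intro x hx
    have : 1 ≤ (x - α) / (β - α) := by rw [le_div_iff₀ (by linarith)]; linarith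
    have hx0 : 0 < x := by linarith
    simp only [min_eq_left this, max_eq_left (show α ≤ x by linarith), max_eq_right zero_le_one]
    field_simp
  · intro x hx hxα
    have : (x - α) / (β - α) ≤ 0 := div_nonpos_of_nonpos_of_nonneg (by linarith) (by linarith)
    simp only [min_eq_right (show (x - α) / (β - α) ≤ 1 by linarith), max_eq_left this, zero_div]
  · intro x hx
    have := hM x
    refine ⟨div_nonneg (le_max_left _ _) this.le, ?_⟩
    simp only
    rw [mul_div_assoc', div_le_one this]
    calc _ ≤ x * 1 := by
          gcongr
          exact max_le zero_le_one (min_le_left _ _)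
      _ ≤ max x α := by rw [mul_one]; exact le_max_left _ _

lemma trap_int {a b : ℝ} (ha : 0 < a) (hab : a < b) {g : ℝ → ℝ} (hg : Continuous g)
    (h1 : ∀ x, Real.exp (-a) ≤ x → x * g x = 1) (h2 : ∀ x, 0 ≤ x → x < Real.exp (-b) → g x = 0)
    (h3 : ∀ x, 0 ≤ x → 0 ≤ g x ∧ x * g x ≤ 1) :
    a ≤ ∫ x in (0:ℝ)..1, g x ∧ ∫ x in (0:ℝ)..1, g x ≤ b := by
  have int : ∀ c d, IntervalIntegrable g volume c d := fun c d => hg.intervalIntegrable c d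
  have one : ∀ c, 0 < c → ∫ x in Real.exp (-c)..1, 1 / x = c := by
    intro c hc
    rw [integral_one_div_of_pos (Real.exp_pos _) one_pos, one_div, ← Real.exp_neg, neg_neg,
      Real.log_exp]
  have oneint : ∀ c, IntervalIntegrable (fun x : ℝ => 1 / x) volume (Real.exp (-c)) 1 := by
    intro c
    refine ContinuousOn.intervalIntegrable ?_
    intro x hx
    have : 0 < x := lt_of_lt_of_le (lt_min (Real.exp_pos _) one_pos) hx.1
    exact ((continuousAt_const).div continuousAt_id this.ne').continuousWithinAt
  have le1 : ∀ c, 0 < c → Real.exp (-c) ≤ 1 := fun c hc => Real.exp_le_one_iff.2 (by linarith)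
  constructor
  · rw [← intervalIntegral.integral_add_adjacent_intervals (int 0 (Real.exp (-a))) (int _ 1)]
    have p1 : 0 ≤ ∫ x in (0:ℝ)..Real.exp (-a), g x :=
      intervalIntegral.integral_nonneg (Real.exp_pos _).le fun x hx => (h3 x hx.1).1
    have p2 : ∫ x in Real.exp (-a)..1, 1 / x ≤ ∫ x in Real.exp (-a)..1, g x := by
      refine intervalIntegral.integral_mono_on (le1 a ha) (oneint a) (int _ _) fun x hx => ?_
      have hx0 : 0 < x := (Real.exp_pos _).trans_le hx.1
      rw [div_le_iff₀ hx0, mul_comm, h1 x hx.1]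
    rw [one a ha] at p2
    linarith
  · have hb := ha.trans hab
    rw [← intervalIntegral.integral_add_adjacent_intervals (int 0 (Real.exp (-b))) (int _ 1)]
    have p1 : ∫ x in (0:ℝ)..Real.exp (-b), g x ≤ ∫ x in (0:ℝ)..Real.exp (-b), (0:ℝ) := by
      refine intervalIntegral.integral_mono_on_of_le_Ioo (Real.exp_pos _).le (int _ _) (by simp)
        fun x hx => (h2 x hx.1.le hx.2).le
    have p2 : ∫ x in Real.exp (-b)..1, g x ≤ ∫ x in Real.exp (-b)..1, 1 / x := by
      refine intervalIntegral.integral_mono_on (le1 b hb) (int _ _) (oneint b) fun x hx => ?_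
      have hx0 : 0 < x := (Real.exp_pos _).trans_le hx.1
      rw [le_div_iff₀ hx0, mul_comm]
      exact (h3 x hx0.le).2
    rw [one b hb] at p2
    simp at p1
    linarith

lemma trap_bounds (hpos : ∀ j, 0 < p j) (hs : Summable p) {a b : ℝ} {g : ℝ → ℝ} (hg : Continuous g)
    (h1 : ∀ x, Real.exp (-a) ≤ x → x * g x = 1) (h2 : ∀ x, 0 ≤ x → x < Real.exp (-b) → g x = 0)
    (h3 : ∀ x, 0 ≤ x → 0 ≤ g x ∧ x * g x ≤ 1) {t : ℝ} (ht : 0 < t) :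
    nuOne p (a / t) ≤ ∑' j, p j * (Real.exp (-t * p j) * g (Real.exp (-t * p j))) ∧
    ∑' j, p j * (Real.exp (-t * p j) * g (Real.exp (-t * p j))) ≤ nuOne p (b / t) := by
  have sg := W_summable hpos hs hg.continuousOn ht
  constructor
  · refine Summable.tsum_le_tsum (fun j => ?_) (nu_summable hpos hs _) sg
    have hp := hpos j
    have e := Real.exp_pos (-t * p j)
    split_ifs with h
    · rw [le_div_iff₀ ht] at h
      rw [h1 _ (Real.exp_le_exp.2 (by linarith)), mul_one]
    · have := (h3 _ e.le).1
      positivity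
  · refine Summable.tsum_le_tsum (fun j => ?_) sg (nu_summable hpos hs _)
    have hp := hpos j
    have e := Real.exp_pos (-t * p j)
    split_ifs with h
    · have := (h3 _ e.le).2
      nlinarith
    · rw [le_div_iff₀ ht] at h
      rw [h2 _ e.le (Real.exp_lt_exp.2 (by linarith)), mul_zero, mul_zero]

lemma tauber (hpos : ∀ j, 0 < p j) (hs : Summable p) {ℓ : ℝ → ℝ}
    (hℓ : ∀ y : ℝ, 0 < y → 0 < ℓ y) (hsv : SlowlyVarying ℓ)
    (h : Tendsto (fun t : ℝ => t * (∑' j, p j * Real.exp (-t * p j)) / ℓ t) atTop (𝓝 1)) :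
    Tendsto (fun t : ℝ => t * nuOne p (1 / t) / ℓ t) atTop (𝓝 1) := by
  rw [tendsto_order]
  constructor
  · intro a' ha'
    obtain ⟨a, ha, ha1⟩ := exists_between (max_lt ha' (zero_lt_one' ℝ))
    have ha0 : 0 < a := (le_max_right _ _).trans_lt ha
    obtain ⟨g, hg, h1, h2, h3⟩ := exists_trap ha0 ha1
    have hi := (trap_int ha0 ha1 hg h1 h2 h3).1
    have hlt : a' < ∫ x in (0:ℝ)..1, g x := ((le_max_left _ _).trans_lt ha).trans_le hi
    filter_upwards [(W_cont hpos hs hℓ hsv h g hg).eventually (lt_mem_nhds hlt),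
      eventually_gt_atTop 0] with t k ht
    refine k.trans_le ?_
    have hl := hℓ t ht
    have := (trap_bounds hpos hs hg h1 h2 h3 ht).2
    gcongr
  · intro b' hb'
    obtain ⟨b, hb1, hb⟩ := exists_between hb'
    obtain ⟨g, hg, h1, h2, h3⟩ := exists_trap one_pos hb1
    have hi := (trap_int one_pos hb1 hg h1 h2 h3).2
    filter_upwards [(W_cont hpos hs hℓ hsv h g hg).eventually (gt_mem_nhds (hi.trans_lt hb)),
      eventually_gt_atTop 0] with t k ht
    refine lt_of_le_of_lt ?_ k
    have hl := hℓ t ht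
    have := (trap_bounds hpos hs hg h1 h2 h3 ht).1
    gcongr

lemma phi_top (hpos : ∀ j, 0 < p j) (hmono : Antitone p) (hs : Summable p) :
    Tendsto (Phi p) atTop atTop := by
  rw [tendsto_atTop]
  intro b
  have hc : 0 < 1 - Real.exp (-1) := by
    have : Real.exp (-1) < 1 := Real.exp_lt_one_iff.2 (by norm_num)
    linarith
  obtain ⟨n, hn⟩ := exists_nat_ge (b / (1 - Real.exp (-1)))
  rw [div_le_iff₀ hc] at hn
  filter_upwards [eventually_ge_atTop (1 / p n)] with t ht
  have hpn := hpos n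
  have ht0 : 0 < t := lt_of_lt_of_le (by positivity) ht
  refine hn.trans (le_trans ?_ (B1 hpos hs ht0 one_pos))
  rw [mul_comm]
  gcongr
  unfold nubar
  have : (Set.Iio n).ncard ≤ {j | 1 / t ≤ p j}.ncard := by
    refine Set.ncard_le_ncard ?_ (fin_ge hs (by positivity))
    intro j hj
    have : p n ≤ p j := hmono (le_of_lt hj)
    refine le_trans ?_ this
    rw [div_le_iff₀ hpn] at ht
    rw [div_le_iff₀ ht0]; linarith
  have e : (Set.Iio n).ncard = n := by
    rw [Set.ncard_eq_toFinset_card']; simp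
  rw [e] at this
  exact_mod_cast this

lemma phi_deriv (hpos : ∀ j, 0 < p j) (hs : Summable p) {t : ℝ} (ht : 0 < t) :
    HasDerivAt (Phi p) (∑' j, p j * Real.exp (-t * p j)) t := by
  refine hasDerivAt_tsum_of_isPreconnected (u := p) (t := Set.Ioi 0) (y₀ := 1)
    (g := fun j t => 1 - Real.exp (-t * p j)) (g' := fun j t => p j * Real.exp (-t * p j))
    hs isOpen_Ioi isPreconnected_Ioi ?_ ?_ ?_ ?_ ht
  · intro j y _
    have := (((hasDerivAt_neg y).mul_const (p j)).exp).const_sub 1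
    refine this.congr_deriv ?_
    ring
  · intro j y hy
    have hm := exp_mem hpos hy j
    rw [norm_mul, Real.norm_of_nonneg (hpos j).le, Real.norm_of_nonneg hm.1]
    have := hpos j
    nlinarith [hm.2]
  · simp
  · exact phi_summable hpos hs zero_le_one

lemma phi_ell (hpos : ∀ j, 0 < p j) (hmono : Antitone p) (hs : Summable p) {ℓ : ℝ → ℝ}
    (hℓ : ∀ y : ℝ, 0 < y → 0 < ℓ y)
    (hi : ∀ y : ℝ, 1 < y → IntegrableOn (fun u : ℝ => ℓ u / u) (Set.Ioc 1 y))
    (h : Tendsto (fun t : ℝ => t * (∑' j, p j * Real.exp (-t * p j)) / ℓ t) atTop (𝓝 1)) :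
    Tendsto (fun t : ℝ => Phi p t / ellInt ℓ t) atTop (𝓝 1) := by
  have s1 : ∀ t, 0 < t → Summable fun j => p j * Real.exp (-t * p j) := by
    intro t ht
    have s1 := W_summable hpos hs (g := fun _ => 1) continuousOn_const ht
    simpa only [mul_one] using s1
  have hFi : ∀ a b, 0 < a → 0 < b →
      IntervalIntegrable (fun t => ∑' j, p j * Real.exp (-t * p j)) volume a b := by
    intro a b ha hb
    refine AntitoneOn.intervalIntegrable ?_
    intro x hx y hy hxy
    have hx0 : 0 < x := (lt_min ha hb).trans_le hx.1
    refine Summable.tsum_le_tsum (fun j => ?_) (s1 y (hx0.trans_le hxy)) (s1 x hx0)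
    have := hpos j
    gcongr
  have hEi : ∀ a b, 1 ≤ a → a ≤ b → IntervalIntegrable (fun u => ℓ u / u) volume a b := by
    intro a b ha hab
    rw [intervalIntegrable_iff_integrableOn_Ioc_of_le hab]
    exact (hi (b + 1) (by linarith)).mono_set (Set.Ioc_subset_Ioc ha (by linarith))
  have hE : ∀ a b, 1 ≤ a → a ≤ b → ∫ u in a..b, ℓ u / u = ellInt ℓ b - ellInt ℓ a := by
    intro a b ha hab
    unfold ellInt
    rw [← intervalIntegral.integral_of_le ha, ← intervalIntegral.integral_of_le (ha.trans hab),
      ← intervalIntegral.integral_add_adjacent_intervals (hEi 1 a le_rfl ha) (hEi a b ha hab)]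
    ring
  have hP : ∀ a b, 0 < a → a ≤ b →
      ∫ t in a..b, (∑' j, p j * Real.exp (-t * p j)) = Phi p b - Phi p a := by
    intro a b ha hab
    refine intervalIntegral.integral_eq_sub_of_hasDerivAt (fun x hx => ?_)
      (hFi a b ha (ha.trans_le hab))
    rw [Set.uIcc_of_le hab] at hx
    exact phi_deriv hpos hs (ha.trans_le hx.1)
  have up : ∀ c, 1 < c → ∃ T, 1 ≤ T ∧ ∀ t, T ≤ t →
      Phi p t - Phi p T ≤ c * (ellInt ℓ t - ellInt ℓ T) := by
    intro c hc
    obtain ⟨T, hT⟩ := eventually_atTop.1 ((h.eventually (gt_mem_nhds hc)).and (eventually_ge_atTop 1))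
    have hT1 := (hT T le_rfl).2
    refine ⟨T, hT1, fun t ht => ?_⟩
    rw [← hP T t (by linarith) ht, ← hE T t hT1 ht, ← intervalIntegral.integral_const_mul]
    refine intervalIntegral.integral_mono_on ht (hFi _ _ (by linarith) (by linarith))
      ((hEi T t hT1 ht).const_mul c) fun x hx => ?_
    have hx0 : 0 < x := by linarith [hx.1]
    have := (hT x hx.1).1.le
    rw [div_le_iff₀ (hℓ x hx0)] at this
    rw [mul_div_assoc', le_div_iff₀ hx0]; linarith
  have lo : ∀ c, c < 1 → ∃ T, 1 ≤ T ∧ ∀ t, T ≤ t →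
      c * (ellInt ℓ t - ellInt ℓ T) ≤ Phi p t - Phi p T := by
    intro c hc
    obtain ⟨T, hT⟩ := eventually_atTop.1 ((h.eventually (lt_mem_nhds hc)).and (eventually_ge_atTop 1))
    have hT1 := (hT T le_rfl).2
    refine ⟨T, hT1, fun t ht => ?_⟩
    rw [← hP T t (by linarith) ht, ← hE T t hT1 ht, ← intervalIntegral.integral_const_mul]
    refine intervalIntegral.integral_mono_on ht 
      ((hEi T t hT1 ht).const_mul c) (hFi _ _ (by linarith) (by linarith)) fun x hx => ?_
    have hx0 : 0 < x := by linarith [hx.1]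
    have := (hT x hx.1).1.le
    rw [le_div_iff₀ (hℓ x hx0)] at this
    rw [mul_div_assoc', div_le_iff₀ hx0]; linarith
  have Etop : Tendsto (ellInt ℓ) atTop atTop := by
    obtain ⟨T, hT1, hT⟩ := up 2 (by norm_num)
    rw [tendsto_atTop]
    intro b
    filter_upwards [eventually_ge_atTop T,
      (phi_top hpos hmono hs).eventually_ge_atTop (2 * b - 2 * ellInt ℓ T + Phi p T)] with t h1 h2
    have := hT t h1
    linarith
  have lim : ∀ c C : ℝ, Tendsto (fun t => c + C / ellInt ℓ t) atTop (𝓝 c) := by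
    intro c C
    have := (Etop.const_div_atTop C).const_add c
    simpa using this
  rw [tendsto_order]
  constructor
  · intro a ha
    obtain ⟨c, hac, hc⟩ := exists_between ha
    obtain ⟨T, hT1, hT⟩ := lo c hc
    filter_upwards [(lim c (Phi p T - c * ellInt ℓ T)).eventually (lt_mem_nhds hac),
      Etop.eventually_gt_atTop 0, eventually_ge_atTop T] with t k1 k2 k3
    refine k1.trans_le ?_
    rw [le_div_iff₀ k2, add_mul, div_mul_cancel₀ _ k2.ne']
    linarith [hT t k3]
  · intro b hb
    obtain ⟨c, hc, hcb⟩ := exists_between hb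
    obtain ⟨T, hT1, hT⟩ := up c hc
    filter_upwards [(lim c (Phi p T - c * ellInt ℓ T)).eventually (gt_mem_nhds hcb),
      Etop.eventually_gt_atTop 0, eventually_ge_atTop T] with t k1 k2 k3
    refine lt_of_le_of_lt ?_ k1
    rw [div_le_iff₀ k2, add_mul, div_mul_cancel₀ _ k2.ne']
    linarith [hT t k3]

lemma nu_conv (ℓ : ℝ → ℝ) :
    Tendsto (fun x : ℝ => nuOne p x / (x * ℓ (1 / x))) (𝓝[>] 0) (𝓝 1) ↔
    Tendsto (fun t : ℝ => t * nuOne p (1 / t) / ℓ t) atTop (𝓝 1) := by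
  rw [zero_atTop_iff]
  refine tendsto_congr fun t => ?_
  rw [one_div_one_div, one_div, mul_comm t, mul_comm t⁻¹, ← div_div, div_inv_eq_mul, div_mul_eq_mul_div]

end helpers

/-- Slow variation: if `ν_1[0,x] ∼ x ℓ_0(1/x)` then, with
`ℓ(y) = ∫_1^y u^{-1} ℓ_0(u) du`, `Φ(t) ∼ ℓ(t)` and `Φ_r(t) ∼ (1/r) ℓ_0(t)` for
every `r ≥ 1`; in particular `ν_1[0,x] ∼ x ℓ_0(1/x)` is equivalent to
`Φ_1(t) ∼ ℓ_0(t)`. Moreover, for any slowly varying `ℓ`, `ν̄(x) ∼ ℓ(1/x)` is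
equivalent to `Φ(t) ∼ ℓ(t)`, and either implies `Φ_r(t)/Φ(t) → 0` for every
`r ≥ 1`. -/
theorem stmt_19 (p : ℕ → ℝ) (hpos : ∀ j, 0 < p j) (hmono : Antitone p)
    (hsum : ∑' j, p j = 1) :
    (∀ ℓ₀ : ℝ → ℝ, Measurable ℓ₀ → (∀ y : ℝ, 0 < y → 0 < ℓ₀ y) →
      SlowlyVarying ℓ₀ →
      (∀ y : ℝ, 1 < y → IntegrableOn (fun u : ℝ => ℓ₀ u / u) (Set.Ioc 1 y)) →
      Tendsto (fun x : ℝ => nuOne p x / (x * ℓ₀ (1 / x))) (𝓝[>] 0) (𝓝 1) →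
      Tendsto (fun t : ℝ => Phi p t / ellInt ℓ₀ t) atTop (𝓝 1) ∧
      (∀ r : ℕ, 1 ≤ r →
        Tendsto (fun t : ℝ => PhiR p r t / (1 / (r : ℝ) * ℓ₀ t)) atTop (𝓝 1))) ∧
    (∀ ℓ₀ : ℝ → ℝ, (∀ y : ℝ, 0 < y → 0 < ℓ₀ y) → SlowlyVarying ℓ₀ →
      (Tendsto (fun x : ℝ => nuOne p x / (x * ℓ₀ (1 / x))) (𝓝[>] 0) (𝓝 1) ↔
        Tendsto (fun t : ℝ => PhiR p 1 t / ℓ₀ t) atTop (𝓝 1))) ∧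
    (∀ ℓ : ℝ → ℝ, (∀ y : ℝ, 0 < y → 0 < ℓ y) → SlowlyVarying ℓ →
      (Tendsto (fun x : ℝ => nubar p x / ℓ (1 / x)) (𝓝[>] 0) (𝓝 1) ↔
        Tendsto (fun t : ℝ => Phi p t / ℓ t) atTop (𝓝 1)) ∧
      (Tendsto (fun t : ℝ => Phi p t / ℓ t) atTop (𝓝 1) →
        ∀ r : ℕ, 1 ≤ r →
          Tendsto (fun t : ℝ => PhiR p r t / Phi p t) atTop (𝓝 0))) := by
  have hs : Summable p := by
    by_contra hc
    rw [tsum_eq_zero_of_not_summable hc] at hsum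
    exact zero_ne_one hsum
  refine ⟨?_, ?_, ?_⟩
  · intro ℓ₀ _ hℓ hsv hi h
    rw [nu_conv] at h
    refine ⟨?_, ?_⟩
    · have := abel hpos hs hℓ hsv h 0
      simp only [pow_zero, one_mul, Nat.factorial_zero, Nat.cast_one] at this
      exact phi_ell hpos hmono hs hℓ hi this
    · intro r hr
      obtain ⟨n, rfl⟩ : ∃ n, r = n + 1 := ⟨r - 1, by omega⟩
      have hf : (n.factorial : ℝ) ≠ 0 := by positivity
      have := (abel hpos hs hℓ hsv h n).div_const (n.factorial : ℝ)
      rw [div_self hf] at this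
      refine this.congr fun t => ?_
      rw [phiR_eq, Nat.factorial_succ]
      have : ((n + 1 : ℕ) : ℝ) ≠ 0 := by positivity
      push_cast at this ⊢
      field_simp
  · intro ℓ₀ hℓ hsv
    rw [nu_conv]
    have e : ∀ t, PhiR p 1 t = t * ∑' j, p j * Real.exp (-t * p j) := by
      intro t
      simp [PhiR]
    simp_rw [e]
    constructor
    · intro h
      have := abel hpos hs hℓ hsv h 0
      simpa only [pow_zero, one_mul, Nat.factorial_zero, Nat.cast_one] using this
    · intro h
      exact tauber hpos hs hℓ hsv h
  · intro ℓ hℓ hsv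
    refine ⟨?_, fun h r hr => phir_o hpos hs hℓ hsv h r hr⟩
    rw [zero_atTop_iff]
    simp_rw [one_div_one_div]
    exact ⟨nu_to_phi hpos hs hℓ hsv, phi_to_nu hpos hs hℓ hsv⟩
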